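/- Let n ∈ ℕ, let (M, f, s, mx, le, zero) be an interpretation satisfying the NiA clause set C(n), and let b : {0, …, n} → {0, …, n} be a bijection. Then for every k ≤ n and every assignment x : ℕ → M: if f (x (i+1)) = num (b i) for all i ≤ k, then there exists i with k < i ≤ n and f (m k x (s (x (k+1)))) = num (b i). (Semantic content of: the clause c'_b(k, n) is derivable by resolution from C(n).) -/

import Mathlib

/-- Numerals in the interpretation: `num 0 = zero`, `num (k+1) = s (num k)`. -/
def num {M : Type*} (s : M → M) (zero : M) : ℕ → M
  | 0 => zero
  | k + 1 => s (num s zero k)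

/-- The iterated max term `m(k, x̄, t)`. -/
def itm {M : Type*} (s : M → M) (mx : M → M → M) : ℕ → (ℕ → M) → M → M
  | 0, _, t => t
  | k + 1, x, t => itm s mx k x (mx (s (x (k + 1))) t)

theorem le_of_itm_le {M : Type*} {s : M → M} {mx : M → M → M} {le : M → M → Prop}
    (hr : ∀ a b c, le (mx a b) c → le b c) {x : ℕ → M} {c : M} (k : ℕ) :
    ∀ t, le (itm s mx k x t) c → le t c := by
  induction k with
  | zero => exact fun _ h => h
  | succ k ih => exact fun t h => hr _ _ _ (ih _ h)

theorem le_of_itm_le_of_lt {M : Type*} {s : M → M} {mx : M → M → M} {le : M → M → Prop}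
    (hl : ∀ a b c, le (mx a b) c → le a c) (hr : ∀ a b c, le (mx a b) c → le b c)
    {x : ℕ → M} {c : M} {i : ℕ} (k : ℕ) :
    ∀ t, i < k → le (itm s mx k x t) c → le (s (x (i + 1))) c := by
  induction k with
  | zero => exact fun _ hi => absurd hi (Nat.not_lt_zero i)
  | succ k ih =>
    intro t hi h
    rcases Nat.lt_succ_iff_lt_or_eq.mp hi with hi | rfl
    · exact ih _ hi h
    · exact hl _ _ _ (le_of_itm_le hr _ _ h)

theorem stmt10 {M : Type*} (n : ℕ) (f s : M → M) (mx : M → M → M)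
    (le : M → M → Prop) (zero : M)
    (hC1 : ∀ a, le a a)
    (hC2 : ∀ a b c, le (mx a b) c → le a c)
    (hC3 : ∀ a b c, le (mx a b) c → le b c)
    (hC4 : ∀ k ≤ n, ∀ a b, ¬ (f b = num s zero k ∧ f a = num s zero k ∧ le (s b) a))
    (hC5 : ∀ a, ∃ i ≤ n, f a = num s zero i)
    (b : ℕ → ℕ) (hb : Set.BijOn b (Set.Iic n) (Set.Iic n)) :
    ∀ k ≤ n, ∀ x : ℕ → M,
      (∀ i ≤ k, f (x (i + 1)) = num s zero (b i)) →
      ∃ i, k < i ∧ i ≤ n ∧ f (itm s mx k x (s (x (k + 1)))) = num s zero (b i) := by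
  intro k hk x hx
  obtain ⟨j, hj, hfj⟩ := hC5 (itm s mx k x (s (x (k + 1))))
  obtain ⟨i, hi, rfl⟩ := hb.surjOn hj
  refine ⟨i, ?_, hi, hfj⟩
  by_contra! hik
  refine hC4 (b i) hj _ _ ⟨hx i hik, hfj, ?_⟩
  rcases hik.lt_or_eq with hik | rfl
  · exact le_of_itm_le_of_lt hC2 hC3 k _ hik (hC1 _)
  · exact le_of_itm_le hC3 i _ (hC1 _)
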